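/- Let A be the Artin group of type D_4 and let (x_0,…,x_5) be a type II 6-cycle. Then at least one of the following holds: (1) there exist left cosets y_1, y_3 of A_â and a left coset y_2 of A_ĉ, each having nonempty intersection with x_2, such that x_1 ∩ y_1, y_1 ∩ y_2, y_2 ∩ y_3 and y_3 ∩ x_3 are all nonempty; (2) there exists a left coset y of A_â with y ∩ x_1 ≠ ∅, y ∩ x_2 ≠ ∅ and y ∩ x_3 ≠ ∅. -/

import Mathlib

/-!
The Artin group of type `D₄`, with generators `a, b, c, d`, where `d` is the central node of
the Dynkin diagram: relations `ada = dad`, `bdb = dbd`, `cdc = dcd`, `ab = ba`, `ac = ca`,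
`bc = cb`.
-/

open Pointwise

namespace D4Artin

/-- The generators of the `D₄` Artin group. -/
inductive Gen : Type
  | a | b | c | d
deriving DecidableEq

open Gen

/-- The defining relators of the `D₄` Artin group: a braid relation `sts = tst` whenever one of
`s, t` is the central node `d`, and commutation `st = ts` otherwise. -/
def Rels : Set (FreeGroup Gen) :=
  { r | ∃ s t : Gen, s ≠ t ∧
      (((s = d ∨ t = d) ∧
          r = FreeGroup.of s * FreeGroup.of t * FreeGroup.of s *
              (FreeGroup.of t * FreeGroup.of s * FreeGroup.of t)⁻¹) ∨
        ((s ≠ d ∧ t ≠ d) ∧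
          r = FreeGroup.of s * FreeGroup.of t * (FreeGroup.of s)⁻¹ * (FreeGroup.of t)⁻¹)) }

/-- The Artin group of type `D₄`. -/
abbrev Artin : Type := PresentedGroup Rels

/-- The generators, as elements of the Artin group. -/
def gen (s : Gen) : Artin := PresentedGroup.of s

/-- The standard parabolic subgroup `A_ŝ` generated by the three generators other than `s`. -/
def Ahat (s : Gen) : Subgroup Artin :=
  Subgroup.closure { x | ∃ t : Gen, t ≠ s ∧ x = gen t }

/-- `X` is a left coset of the subgroup `H`. -/
def IsCosetOf (X : Set Artin) (H : Subgroup Artin) : Prop :=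
  ∃ g : Artin, X = g • (H : Set Artin)

/-- A type II 6-cycle: `x 0, x 4` are distinct left cosets of `A_â`, `x 2` is a left coset of
`A_b̂`, `x 1, x 3, x 5` are pairwise distinct left cosets of `A_ĉ`, and consecutive cosets
(indices mod 6) have nonempty intersection. -/
def TypeII (x : Fin 6 → Set Artin) : Prop :=
  IsCosetOf (x 0) (Ahat a) ∧ IsCosetOf (x 4) (Ahat a) ∧ IsCosetOf (x 2) (Ahat b) ∧
  IsCosetOf (x 1) (Ahat c) ∧ IsCosetOf (x 3) (Ahat c) ∧ IsCosetOf (x 5) (Ahat c) ∧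
  x 0 ≠ x 4 ∧ x 1 ≠ x 3 ∧ x 1 ≠ x 5 ∧ x 3 ≠ x 5 ∧
  ∀ i : Fin 6, (x i ∩ x (i + 1)).Nonempty

end D4Artin

open D4Artin D4Artin.Gen

namespace D4Artin

theorem gen_braid {s : Gen} (hs : s ≠ d) :
    gen s * gen d * gen s = gen d * gen s * gen d := by
  have h := PresentedGroup.one_of_mem (rels := Rels) ⟨s, d, hs, Or.inl ⟨Or.inr rfl, rfl⟩⟩
  simp only [map_mul, map_inv, mul_inv_eq_one] at h
  exact h

theorem gen_comm {s t : Gen} (hst : s ≠ t) (hs : s ≠ d) (ht : t ≠ d) :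
    gen s * gen t = gen t * gen s := by
  have h := PresentedGroup.one_of_mem (rels := Rels) ⟨s, t, hst, Or.inr ⟨⟨hs, ht⟩, rfl⟩⟩
  simp only [map_mul, map_inv] at h
  rwa [mul_inv_eq_one, mul_inv_eq_iff_eq_mul] at h

/-- The permutation action of the Coxeter group of type `D₄` on the eight cosets of the standard
parabolic subgroup obtained by omitting `b`. The coset of the identity is `0`. -/
def move : Gen → Fin 8 → Fin 8
  | a => ![0, 1, 3, 2, 5, 4, 6, 7]
  | b => ![1, 0, 2, 3, 4, 5, 7, 6]
  | c => ![0, 1, 4, 5, 2, 3, 6, 7]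
  | d => ![0, 2, 1, 3, 4, 6, 5, 7]

/-- If the generator `s` fixes the coset `v` with minimal representative `w`, then `label s v` is
the generator conjugate to `s` by `w`; otherwise `label s v` is `none`. -/
def label : Gen → Fin 8 → Option Gen
  | a => ![some a, some a, none, none, none, none, some c, some c]
  | b => ![none, none, some d, some d, some d, some d, none, none]
  | c => ![some c, some c, none, none, none, none, some a, some a]
  | d => ![some d, none, none, some a, some c, none, none, some d]

theorem move_move (s : Gen) (v : Fin 8) : move s (move s v) = v := by
  cases s <;> revert v <;> decide

theorem label_move (s : Gen) (v : Fin 8) : label s (move s v) = label s v := by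
  cases s <;> revert v <;> decide

/-- The element of the Artin group named by a label. -/
def ofLabel (o : Option Gen) : Artin := o.elim 1 gen

/-- The action of a generator on pairs of a coset and an accumulated product of labels. -/
def step (s : Gen) : Equiv.Perm (Fin 8 × Artin) where
  toFun p := (move s p.1, ofLabel (label s p.1) * p.2)
  invFun p := (move s p.1, (ofLabel (label s p.1))⁻¹ * p.2)
  left_inv p := by simp [move_move, label_move]
  right_inv p := by simp [move_move, label_move]

theorem step_apply (s : Gen) (p : Fin 8 × Artin) :
    step s p = (move s p.1, ofLabel (label s p.1) * p.2) := rfl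

theorem step_braid {s : Gen} (hs : s ≠ d) : step s * step d * step s = step d * step s * step d := by
  ext1 ⟨v, g⟩
  have ha := gen_braid (s := a) (by decide)
  have hc := gen_braid (s := c) (by decide)
  cases s <;> first | contradiction | skip
  all_goals
    fin_cases v <;>
      simp [Equiv.Perm.mul_apply, step_apply, move, label, ofLabel, ← mul_assoc, ha, hc]

theorem step_comm {s t : Gen} (hst : s ≠ t) (hs : s ≠ d) (ht : t ≠ d) :
    step s * step t = step t * step s := by
  ext1 ⟨v, g⟩
  have hac := gen_comm (s := a) (t := c) (by decide) (by decide) (by decide)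
  cases s <;> cases t <;> first | contradiction | skip
  all_goals
    fin_cases v <;>
      simp [Equiv.Perm.mul_apply, step_apply, move, label, ofLabel, ← mul_assoc, hac]

/-- The action of the Artin group on pairs of a coset and an accumulated product of labels. -/
def act : Artin →* Equiv.Perm (Fin 8 × Artin) :=
  PresentedGroup.toGroup (f := step) (by
    rintro r ⟨s, t, hst, ⟨hd, rfl⟩ | ⟨⟨hs, ht⟩, rfl⟩⟩
    · simp only [map_mul, map_inv, FreeGroup.lift_apply_of, mul_inv_eq_one]
      rcases hd with rfl | rfl
      · exact (step_braid hst.symm).symm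
      · exact step_braid hst
    · simp only [map_mul, map_inv, FreeGroup.lift_apply_of]
      rw [mul_inv_eq_one, mul_inv_eq_iff_eq_mul]
      exact step_comm hst hs ht)

theorem act_gen (s : Gen) (p : Fin 8 × Artin) :
    act (gen s) p = (move s p.1, ofLabel (label s p.1) * p.2) := by
  rw [act, gen, PresentedGroup.toGroup.of, step_apply]

/-- The subgroup generated by the generators in `L`. -/
def parabolic (L : Finset Gen) : Subgroup Artin := Subgroup.closure (gen '' L)

theorem parabolic_le_Ahat {L : Finset Gen} {s : Gen} (hs : s ∉ L) : parabolic L ≤ Ahat s := by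
  refine Subgroup.closure_mono ?_
  rintro _ ⟨t, ht, rfl⟩
  exact ⟨t, fun h => hs (h ▸ ht), rfl⟩

/-- If a set `V` of cosets is stable under the generators other than `s`, with all labels occurring
in `V` lying in `L`, then `A_ŝ` multiplies the accumulated product over `V` by elements of
`parabolic L`. -/
theorem act_Ahat {s : Gen} {V : Finset (Fin 8)} {L : Finset Gen}
    (hV : ∀ t, t ≠ s → ∀ v, (move t v ∈ V ↔ v ∈ V) ∧ (v ∈ V → ∀ x ∈ label t v, x ∈ L))
    {u : Artin} (hu : u ∈ Ahat s) (p : Fin 8 × Artin) :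
    ((act u p).1 ∈ V ↔ p.1 ∈ V) ∧ (p.1 ∈ V → (act u p).2 * p.2⁻¹ ∈ parabolic L) := by
  induction hu using Subgroup.closure_induction generalizing p with
  | mem x hx =>
    obtain ⟨t, ht, rfl⟩ := hx
    obtain ⟨h1, h2⟩ := hV t ht p.1
    rw [act_gen]
    refine ⟨h1, fun hp => ?_⟩
    simp only [mul_inv_cancel_right]
    rcases hl : label t p.1 with _ | x
    · exact one_mem _
    · exact Subgroup.subset_closure ⟨x, h2 hp x hl, rfl⟩
  | one => simp
  | mul x y _ _ hx hy =>
    rw [map_mul, Equiv.Perm.mul_apply]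
    refine ⟨(hx _).1.trans (hy p).1, fun hp => ?_⟩
    simpa [mul_assoc] using mul_mem ((hx _).2 ((hy p).1.2 hp)) ((hy p).2 hp)
  | inv x _ hx =>
    obtain ⟨h1, h2⟩ := hx (act x⁻¹ p)
    have hxp : act x (act x⁻¹ p) = p := by
      rw [← Equiv.Perm.mul_apply, ← map_mul, mul_inv_cancel, map_one, Equiv.Perm.one_apply]
    rw [hxp] at h1 h2
    exact ⟨h1.symm, fun hp => by simpa using inv_mem (h2 (h1.1 hp))⟩

theorem act_Ahat_a_mem {u : Artin} (hu : u ∈ Ahat a) (p : Fin 8 × Artin) :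
    (act u p).2 * p.2⁻¹ ∈ parabolic {a, d} ∨ (act u p).2 * p.2⁻¹ ∈ parabolic {c, d} := by
  by_cases hp : p.1 ∈ ({0, 1, 2, 4} : Finset (Fin 8))
  · refine Or.inr ((act_Ahat ?_ hu p).2 hp)
    intro t ht
    cases t <;> first | contradiction | decide
  · refine Or.inl ((act_Ahat (V := {0, 1, 2, 4}ᶜ) ?_ hu p).2 (Finset.mem_compl.2 hp))
    intro t ht
    cases t <;> first | contradiction | decide

theorem act_Ahat_c {u : Artin} (hu : u ∈ Ahat c) (p : Fin 8 × Artin) :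
    ((act u p).1 ∈ ({0, 1, 2, 3} : Finset (Fin 8)) ↔ p.1 ∈ ({0, 1, 2, 3} : Finset (Fin 8))) ∧
      (p.1 ∈ ({0, 1, 2, 3} : Finset (Fin 8)) → (act u p).2 * p.2⁻¹ ∈ parabolic {a, d}) := by
  refine act_Ahat ?_ hu p
  intro t ht
  cases t <;> first | contradiction | decide

theorem act_Ahat_c_mem {u : Artin} (hu : u ∈ Ahat c) (p : Fin 8 × Artin) :
    (act u p).2 * p.2⁻¹ ∈ parabolic {a, d} ∨ (act u p).2 * p.2⁻¹ ∈ parabolic {c, d} := by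
  by_cases hp : p.1 ∈ ({0, 1, 2, 3} : Finset (Fin 8))
  · exact Or.inl ((act_Ahat_c hu p).2 hp)
  · refine Or.inr ((act_Ahat (V := {0, 1, 2, 3}ᶜ) ?_ hu p).2 (Finset.mem_compl.2 hp))
    intro t ht
    cases t <;> first | contradiction | decide

theorem act_Ahat_b {h : Artin} (hh : h ∈ Ahat b) (g : Artin) : act h (0, g) = (0, h * g) := by
  induction hh using Subgroup.closure_induction generalizing g with
  | mem x hx =>
    obtain ⟨t, ht, rfl⟩ := hx
    rw [act_gen]
    cases t <;> first | contradiction | rfl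
  | one => simp
  | mul x y _ _ hx hy => rw [map_mul, Equiv.Perm.mul_apply, hy, hx, mul_assoc]
  | inv x _ hx => rw [map_inv, Equiv.Perm.inv_eq_iff_eq, hx, mul_inv_cancel_left]

/-- An element of `A_b̂` of the form `u₁ v₁ u₂ v₂ u₃` with `uᵢ ∈ A_ĉ` and `vᵢ ∈ A_â` can be
rewritten in the same form with all five factors in `A_b̂`. -/
theorem exists_factorization {u₁ v₁ u₂ v₂ u₃ : Artin} (hu₁ : u₁ ∈ Ahat c) (hv₁ : v₁ ∈ Ahat a)
    (hu₂ : u₂ ∈ Ahat c) (hv₂ : v₂ ∈ Ahat a) (hu₃ : u₃ ∈ Ahat c)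
    (hb : u₁ * v₁ * u₂ * v₂ * u₃ ∈ Ahat b) :
    ∃ q₁ ∈ parabolic {a, d}, ∃ r₁ ∈ parabolic {c, d}, ∃ q₂ ∈ parabolic {a, d},
      ∃ r₂ ∈ parabolic {c, d}, ∃ q₃ ∈ parabolic {a, d},
        u₁ * v₁ * u₂ * v₂ * u₃ = q₁ * r₁ * q₂ * r₂ * q₃ := by
  have hact := act_Ahat_b hb 1
  simp only [map_mul, Equiv.Perm.mul_apply, mul_one] at hact
  have h₃ := (act_Ahat_c hu₃ (0, 1)).2 (by decide)
  set p₃ := act u₃ (0, 1)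
  have h₄ := act_Ahat_a_mem hv₂ p₃
  set p₄ := act v₂ p₃
  have h₅ := act_Ahat_c_mem hu₂ p₄
  set p₅ := act u₂ p₄
  have h₆ := act_Ahat_a_mem hv₁ p₅
  set p₆ := act v₁ p₅
  have h₇ := (act_Ahat_c hu₁ p₆).2 ((act_Ahat_c hu₁ p₆).1.1 (by simp [hact]))
  rw [hact] at h₇
  generalize u₁ * v₁ * u₂ * v₂ * u₃ = h at h₇ ⊢
  have e : h = h * p₆.2⁻¹ * (p₆.2 * p₅.2⁻¹) * (p₅.2 * p₄.2⁻¹) * (p₄.2 * p₃.2⁻¹) *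
      (p₃.2 * 1⁻¹) := by group
  revert h₃ h₄ h₅ h₆ h₇ e
  generalize h * p₆.2⁻¹ = k₁, p₆.2 * p₅.2⁻¹ = m₁, p₅.2 * p₄.2⁻¹ = m₂, p₄.2 * p₃.2⁻¹ = m₃,
    p₃.2 * 1⁻¹ = k₂
  intro h₃ h₄ h₅ h₆ h₇ e
  rcases h₆ with h₆ | h₆ <;> rcases h₅ with h₅ | h₅ <;> rcases h₄ with h₄ | h₄
  · exact ⟨k₁, h₇, 1, one_mem _, m₁ * m₂ * m₃, mul_mem (mul_mem h₆ h₅) h₄, 1, one_mem _, k₂, h₃,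
      by rw [e]; group⟩
  · exact ⟨k₁, h₇, 1, one_mem _, m₁ * m₂, mul_mem h₆ h₅, m₃, h₄, k₂, h₃, by rw [e]; group⟩
  · exact ⟨k₁ * m₁, mul_mem h₇ h₆, m₂, h₅, m₃, h₄, 1, one_mem _, k₂, h₃, by rw [e]; group⟩
  · exact ⟨k₁ * m₁, mul_mem h₇ h₆, m₂ * m₃, mul_mem h₅ h₄, 1, one_mem _, 1, one_mem _, k₂, h₃,
      by rw [e]; group⟩
  · exact ⟨k₁, h₇, m₁, h₆, m₂ * m₃, mul_mem h₅ h₄, 1, one_mem _, k₂, h₃, by rw [e]; group⟩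
  · exact ⟨k₁, h₇, m₁, h₆, m₂, h₅, m₃, h₄, k₂, h₃, by rw [e]⟩
  · exact ⟨k₁, h₇, m₁ * m₂, mul_mem h₆ h₅, m₃, h₄, 1, one_mem _, k₂, h₃, by rw [e]; group⟩
  · exact ⟨k₁, h₇, m₁ * m₂ * m₃, mul_mem (mul_mem h₆ h₅) h₄, 1, one_mem _, 1, one_mem _, k₂, h₃,
      by rw [e]; group⟩

theorem IsCosetOf.inv_mul_mem {X : Set Artin} {H : Subgroup Artin} (hX : IsCosetOf X H)
    {p q : Artin} (hp : p ∈ X) (hq : q ∈ X) : p⁻¹ * q ∈ H := by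
  obtain ⟨g, rfl⟩ := hX
  rw [mem_leftCoset_iff] at hp hq
  simpa [mul_assoc] using mul_mem (inv_mem hp) hq

theorem IsCosetOf.mul_mem {X : Set Artin} {H : Subgroup Artin} (hX : IsCosetOf X H)
    {p h : Artin} (hp : p ∈ X) (hh : h ∈ H) : p * h ∈ X := by
  obtain ⟨g, rfl⟩ := hX
  rw [mem_leftCoset_iff] at hp ⊢
  simpa [mul_assoc] using H.mul_mem hp hh

theorem isCosetOf_smul (g : Artin) (H : Subgroup Artin) : IsCosetOf (g • (H : Set Artin)) H :=
  ⟨g, rfl⟩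

theorem mem_smul_self (g : Artin) (H : Subgroup Artin) : g ∈ g • (H : Set Artin) :=
  mem_own_leftCoset H.toSubmonoid g

end D4Artin

/-- For every type II 6-cycle `(x 0, …, x 5)` in the `D₄` Artin complex, either (1) there is an
edge path `x 1, y 1, y 2, y 3, x 3` in the link of `x 2`, with `y 1, y 3` left cosets of `A_â`
and `y 2` a left coset of `A_ĉ` each meeting `x 2`; or (2) there is a left coset of `A_â`
meeting each of `x 1`, `x 2`, `x 3`. -/
theorem typeII_local_structure (x : Fin 6 → Set Artin) (hx : TypeII x) :
    (∃ y1 y2 y3 : Set Artin,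
      IsCosetOf y1 (Ahat a) ∧ IsCosetOf y3 (Ahat a) ∧ IsCosetOf y2 (Ahat c) ∧
      (y1 ∩ x 2).Nonempty ∧ (y2 ∩ x 2).Nonempty ∧ (y3 ∩ x 2).Nonempty ∧
      (x 1 ∩ y1).Nonempty ∧ (y1 ∩ y2).Nonempty ∧ (y2 ∩ y3).Nonempty ∧
      (y3 ∩ x 3).Nonempty) ∨
    (∃ y : Set Artin, IsCosetOf y (Ahat a) ∧
      (y ∩ x 1).Nonempty ∧ (y ∩ x 2).Nonempty ∧ (y ∩ x 3).Nonempty) := by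
  obtain ⟨h0, h4, h2, h1, h3, h5, -, -, -, -, hx⟩ := hx
  obtain ⟨p0, hp00, hp01⟩ := hx 0
  obtain ⟨p1, hp11, hp12⟩ := hx 1
  obtain ⟨p2, hp22, hp23⟩ := hx 2
  obtain ⟨p3, hp33, hp34⟩ := hx 3
  obtain ⟨p4, hp44, hp45⟩ := hx 4
  obtain ⟨p5, hp55, hp50⟩ := hx 5
  have e : p1⁻¹ * p2 = p1⁻¹ * p0 * (p0⁻¹ * p5) * (p5⁻¹ * p4) * (p4⁻¹ * p3) * (p3⁻¹ * p2) := by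
    group
  obtain ⟨q₁, hq₁, r₁, hr₁, q₂, hq₂, r₂, hr₂, q₃, hq₃, heq⟩ := exists_factorization
    (h1.inv_mul_mem hp11 hp01) (h0.inv_mul_mem hp00 hp50) (h5.inv_mul_mem hp55 hp45)
    (h4.inv_mul_mem hp44 hp34) (h3.inv_mul_mem hp33 hp23) (e ▸ h2.inv_mul_mem hp12 hp22)
  have hpb : parabolic {a, d} ≤ Ahat b := parabolic_le_Ahat (by decide)
  have hpc : parabolic {a, d} ≤ Ahat c := parabolic_le_Ahat (by decide)
  have hqb : parabolic {c, d} ≤ Ahat b := parabolic_le_Ahat (by decide)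
  have hqa : parabolic {c, d} ≤ Ahat a := parabolic_le_Ahat (by decide)
  have hend : p1 * q₁ * r₁ * q₂ * r₂ = p2 * q₃⁻¹ := by
    rw [← e, inv_mul_eq_iff_eq_mul] at heq
    rw [heq]
    group
  have hx₁ : p1 * q₁ ∈ x 2 := h2.mul_mem hp12 (hpb hq₁)
  have hx₂ : p1 * q₁ * r₁ ∈ x 2 := h2.mul_mem hx₁ (hqb hr₁)
  have hx₃ : p1 * q₁ * r₁ * q₂ ∈ x 2 := h2.mul_mem hx₂ (hpb hq₂)
  have hy₁ := isCosetOf_smul (p1 * q₁) (Ahat a)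
  have hy₂ := isCosetOf_smul (p1 * q₁ * r₁) (Ahat c)
  have hy₃ := isCosetOf_smul (p1 * q₁ * r₁ * q₂) (Ahat a)
  exact Or.inl ⟨_, _, _, hy₁, hy₃, hy₂,
    ⟨_, mem_smul_self _ _, hx₁⟩, ⟨_, mem_smul_self _ _, hx₂⟩, ⟨_, mem_smul_self _ _, hx₃⟩,
    ⟨_, h1.mul_mem hp11 (hpc hq₁), mem_smul_self _ _⟩,
    ⟨_, hy₁.mul_mem (mem_smul_self _ _) (hqa hr₁), mem_smul_self _ _⟩,
    ⟨_, hy₂.mul_mem (mem_smul_self _ _) (hpc hq₂), mem_smul_self _ _⟩,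
    ⟨_, hy₃.mul_mem (mem_smul_self _ _) (hqa hr₂),
      hend ▸ h3.mul_mem hp23 (inv_mem (hpc hq₃))⟩⟩
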